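/- arXiv:1607.01686 — 8 statements merged into one kernel-verified Lean document; each statement's English description precedes it below -/
import Mathlib

section
/- The problem ∞-ZEROS (having infinitely many zeros) for primitive recursive functions is Π2-complete, in the following uniform sense: (i) for every primitive recursive family F, the set {n : ℕ | the set {y | F n y = 0} is infinite} is Π2; and (ii) there exists a primitive recursive family F such that this set is Π2-complete, i.e. every Π2 subset of ℕ many-one reduces to it. -/
def IsPi2 (P : ℕ → Prop) : Prop :=
  ∃ R : ℕ → ℕ → ℕ → Bool,
    Computable (fun p : ℕ × ℕ × ℕ => R p.1 p.2.1 p.2.2) ∧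
    ∀ n, P n ↔ ∀ y, ∃ z, R n y z = true

def Pi2Complete (Q : ℕ → Prop) : Prop :=
  IsPi2 Q ∧ ∀ P : ℕ → Prop, IsPi2 P → ManyOneReducible P Q

open Nat.Partrec (Code)
open Nat.Partrec.Code

def AA (p : Code × ℕ) (L : ℕ) : Prop := ∀ y < L, (evaln p.2 p.1 y).isSome = true

theorem AA_primrec : PrimrecRel fun (L : ℕ) (p : Code × ℕ) => AA p L := by
  have h : PrimrecRel fun (y : ℕ) (p : Code × ℕ) => (evaln p.2 p.1 y).isSome = true := by
    apply PrimrecRel.comp (Primrec.eq (α := Bool)) _ (Primrec.const true)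
    exact Primrec.option_isSome.comp (primrec_evaln.comp
      (((Primrec.snd.comp Primrec.snd).pair (Primrec.fst.comp Primrec.snd)).pair Primrec.fst))
  exact (h.forall_mem_list.comp (Primrec.list_range.comp Primrec.fst) Primrec.snd).of_eq
    (by simp [AA])

theorem AA_mono {c : Code} {k k' L : ℕ} (h : k ≤ k') (H : AA (c, k) L) : AA (c, k') L := by
  intro y hy
  obtain ⟨x, hx⟩ := Option.isSome_iff_exists.1 (H y hy)
  exact Option.isSome_iff_exists.2 ⟨x, evaln_mono h hx⟩

def ZZ (e s : ℕ) : Prop :=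
  AA (Denumerable.ofNat Code e, s.unpair.2 + 1) s.unpair.1 ∧
    ¬ AA (Denumerable.ofNat Code e, s.unpair.2) s.unpair.1

theorem ZZ_primrec : PrimrecRel ZZ := by
  have hc : Primrec fun p : ℕ × ℕ => Denumerable.ofNat Code p.1 :=
    (Primrec.ofNat Code).comp Primrec.fst
  have h1 : Primrec fun p : ℕ × ℕ => p.2.unpair.1 :=
    Primrec.fst.comp (Primrec.unpair.comp Primrec.snd)
  have h2 : Primrec fun p : ℕ × ℕ => p.2.unpair.2 :=
    Primrec.snd.comp (Primrec.unpair.comp Primrec.snd)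
  exact (AA_primrec.comp h1 (hc.pair (Primrec.succ.comp h2))).and
    (AA_primrec.comp h1 (hc.pair h2)).not

theorem AA_total {c : Code} (h : ∀ y, (eval c y).Dom) (L : ℕ) : ∃ k, AA (c, k) L := by
  induction L with
  | zero => exact ⟨0, fun y hy => absurd hy (Nat.not_lt_zero y)⟩
  | succ L ih =>
    obtain ⟨k, hk⟩ := ih
    obtain ⟨x, hx⟩ := Part.dom_iff_mem.1 (h L)
    obtain ⟨k', hk'⟩ := evaln_complete.1 hx
    refine ⟨max k k', fun y hy => ?_⟩
    rcases Nat.lt_succ_iff_lt_or_eq.1 hy with h1 | rfl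
    · exact AA_mono (le_max_left k k') hk y h1
    · exact Option.isSome_iff_exists.2 ⟨x, evaln_mono (le_max_right k k') hk'⟩

theorem ZZ_infinite (e : ℕ) :
    {s | ZZ e s}.Infinite ↔ ∀ y, (eval (Denumerable.ofNat Code e) y).Dom := by
  classical
  constructor
  · intro h y
    by_contra hy
    apply h
    have hinj : Set.InjOn (fun s : ℕ => s.unpair.1) {s | ZZ e s} := by
      intro s hs t ht hst
      simp only at hst
      obtain ⟨hs1, hs2⟩ := hs
      obtain ⟨ht1, ht2⟩ := ht
      have : s.unpair.2 = t.unpair.2 := by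
        rw [hst] at hs1 hs2
        rcases lt_trichotomy s.unpair.2 t.unpair.2 with h | h | h
        · exact absurd (AA_mono h hs1) ht2
        · exact h
        · exact absurd (AA_mono h ht1) hs2
      rw [← Nat.pair_unpair s, ← Nat.pair_unpair t, hst, this]
    refine Set.Finite.of_finite_image ((Set.finite_Iic y).subset ?_) hinj
    rintro _ ⟨s, hs, rfl⟩
    by_contra hlt
    obtain ⟨x, hx⟩ := Option.isSome_iff_exists.1 (hs.1 y (not_le.1 hlt))
    exact hy (Part.dom_iff_mem.2 ⟨x, evaln_sound hx⟩)
  · intro h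
    rw [Set.infinite_iff_exists_gt]
    intro a
    have hex := AA_total h (a + 1)
    have hs := Nat.find_spec hex
    have h0 : Nat.find hex ≠ 0 := by
      intro h0
      rw [h0] at hs
      have := hs 0 (Nat.succ_pos a)
      simp [evaln] at this
    obtain ⟨k, hk⟩ := Nat.exists_eq_succ_of_ne_zero h0
    refine ⟨Nat.pair (a + 1) k, ⟨?_, ?_⟩, Nat.left_le_pair (a + 1) k⟩
    · rw [Nat.unpair_pair]
      rw [hk] at hs
      exact hs
    · rw [Nat.unpair_pair]
      exact Nat.find_min hex (by omega)

theorem zeros_isPi2 (F : ℕ → ℕ → ℕ) (hF : Primrec₂ F) :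
    IsPi2 fun n => {y | F n y = 0}.Infinite := by
  refine ⟨fun n y z => decide (F n z = 0 ∧ y < z), ?_, ?_⟩
  · apply Primrec.to_comp
    apply PrimrecPred.decide
    have hz : Primrec fun p : ℕ × ℕ × ℕ => p.2.2 := Primrec.snd.comp Primrec.snd
    exact (Primrec.eq.comp (hF.comp Primrec.fst hz) (Primrec.const 0)).and
      (Primrec.nat_lt.comp (Primrec.fst.comp Primrec.snd) hz)
  · intro n
    beta_reduce
    rw [Set.infinite_iff_exists_gt]
    simp

theorem infinitelyManyZeros_Pi2_complete :
    (∀ F : ℕ → ℕ → ℕ, Primrec₂ F → IsPi2 fun n => {y | F n y = 0}.Infinite) ∧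
    (∃ F : ℕ → ℕ → ℕ, Primrec₂ F ∧
      Pi2Complete fun n => {y | F n y = 0}.Infinite) := by
  classical
  refine ⟨zeros_isPi2, fun e s => if ZZ e s then 0 else 1, ?_⟩
  have hF : Primrec₂ fun e s => if ZZ e s then 0 else 1 :=
    Primrec.ite ZZ_primrec (Primrec.const 0) (Primrec.const 1)
  refine ⟨hF, zeros_isPi2 _ hF, ?_⟩
  rintro P ⟨R, hR, hP⟩
  have hpart : Partrec fun m : ℕ =>
      Nat.rfind fun z => Part.some (R m.unpair.1 m.unpair.2 z) := by
    apply Partrec.rfind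
    have hm : Computable fun p : ℕ × ℕ => p.1.unpair := Computable.unpair.comp Computable.fst
    exact (hR.comp ((Computable.fst.comp hm).pair
      ((Computable.snd.comp hm).pair Computable.snd))).partrec
  obtain ⟨c, hc⟩ := exists_code.1 (Partrec.nat_iff.1 hpart)
  refine ⟨fun n => Encodable.encode (curry c n), ?_, ?_⟩
  · exact (Primrec.encode.comp (primrec₂_curry.comp (Primrec.const c) Primrec.id)).to_comp
  · intro n
    have h1 : {y | (if ZZ (Encodable.encode (curry c n)) y then 0 else 1) = 0} =
        {y | ZZ (Encodable.encode (curry c n)) y} := by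
      ext y; simp
    show P n ↔ {y | (if ZZ (Encodable.encode (curry c n)) y then 0 else 1) = 0}.Infinite
    rw [h1, ZZ_infinite, hP, Denumerable.ofNat_encode]
    refine forall_congr' fun y => ?_
    rw [eval_curry, hc]
    simp only [Nat.unpair_pair]
    refine Iff.trans ?_ Nat.rfind_dom.symm
    refine exists_congr fun z => ⟨fun h => ⟨?_, fun _ => trivial⟩, fun h => ?_⟩
    · rw [h]; exact Part.mem_some _
    · exact (Part.mem_some_iff.1 h.1).symm
end

section
/- The problem ALMOST-ALL-ZEROS for primitive recursive functions is Σ2-complete, in the following uniform sense: (i) for every primitive recursive family F, the set {n : ℕ | ∃ m, ∀ y ≥ m, F n y = 0} is Σ2; and (ii) there exists a primitive recursive family F such that the set {n : ℕ | ∃ m, ∀ y ≥ m, F n y = 0} is Σ2-complete, i.e. every Σ2 subset of ℕ many-one reduces to it. -/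
def IsSigma2 (P : ℕ → Prop) : Prop :=
  ∃ R : ℕ → ℕ → ℕ → Bool,
    Computable (fun p : ℕ × ℕ × ℕ => R p.1 p.2.1 p.2.2) ∧
    ∀ n, P n ↔ ∃ y, ∀ z, R n y z = true

def Sigma2Complete (Q : ℕ → Prop) : Prop :=
  IsSigma2 Q ∧ ∀ P : ℕ → Prop, IsSigma2 P → ManyOneReducible P Q

open Nat.Partrec in
def aazStep (n s g : ℕ) : Bool :=
  (Code.evaln s (Denumerable.ofNat Code n.unpair.1) (Nat.pair n.unpair.2 g)).isSome

def aazG (n : ℕ) (s : ℕ) : ℕ :=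
  Nat.rec 0 (fun s g => bif aazStep n s g then g + 1 else g) s

def aazF (n s : ℕ) : ℕ := bif aazStep n s (aazG n s) then 1 else 0

theorem aazG_succ (n s : ℕ) :
    aazG n (s + 1) = bif aazStep n s (aazG n s) then aazG n s + 1 else aazG n s := rfl

open Nat.Partrec in
theorem aazStep_prim : Primrec fun p : ℕ × ℕ × ℕ => aazStep p.1 p.2.1 p.2.2 := by
  have hu : Primrec fun p : ℕ × ℕ × ℕ => p.1.unpair := Primrec.unpair.comp Primrec.fst
  have hs : Primrec fun p : ℕ × ℕ × ℕ => p.2.1 := Primrec.fst.comp Primrec.snd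
  have hg : Primrec fun p : ℕ × ℕ × ℕ => p.2.2 := Primrec.snd.comp Primrec.snd
  have hc : Primrec fun p : ℕ × ℕ × ℕ => Denumerable.ofNat Code p.1.unpair.1 :=
    (Primrec.ofNat Code).comp (Primrec.fst.comp hu)
  have ha : Primrec fun p : ℕ × ℕ × ℕ => Nat.pair p.1.unpair.2 p.2.2 :=
    Primrec₂.natPair.comp (Primrec.snd.comp hu) hg
  exact Primrec.option_isSome.comp
    (Code.primrec_evaln.comp (Primrec.pair (Primrec.pair hs hc) ha))

theorem aazG_prim : Primrec₂ aazG := by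
  refine Primrec.nat_rec (f := fun _ : ℕ => 0)
    (g := fun n (p : ℕ × ℕ) => bif aazStep n p.1 p.2 then p.2 + 1 else p.2)
    (Primrec.const 0) ?_
  have hg : Primrec fun p : ℕ × ℕ × ℕ => p.2.2 := Primrec.snd.comp Primrec.snd
  exact Primrec.cond aazStep_prim (Primrec.succ.comp hg) hg

theorem aazF_prim : Primrec₂ aazF := by
  have : Primrec fun p : ℕ × ℕ => aazStep p.1 p.2 (aazG p.1 p.2) :=
    aazStep_prim.comp (Primrec.pair Primrec.fst (Primrec.pair Primrec.snd
      (aazG_prim.comp Primrec.fst Primrec.snd)))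
  exact Primrec.cond this (Primrec.const 1) (Primrec.const 0)

theorem aazF_zero (n s : ℕ) : aazF n s = 0 ↔ aazStep n s (aazG n s) = false := by
  unfold aazF; cases aazStep n s (aazG n s) <;> simp

theorem aazStep_mono {n s t g : ℕ} (h : s ≤ t) (hs : aazStep n s g = true) :
    aazStep n t g = true := by
  unfold aazStep at *
  rw [Option.isSome_iff_exists] at *
  obtain ⟨a, ha⟩ := hs
  exact ⟨a, Nat.Partrec.Code.evaln_mono h ha⟩

theorem aazG_mono (n : ℕ) : Monotone (aazG n) := by
  refine monotone_nat_of_le_succ fun s => ?_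
  rw [aazG_succ]; cases aazStep n s (aazG n s) <;> simp

theorem aazF_iff (n : ℕ) :
    (∃ m, ∀ y ≥ m, aazF n y = 0) ↔ ∃ y, ∀ s, aazStep n s y = false := by
  constructor
  · rintro ⟨m, hm⟩
    have hc : ∀ k, aazG n (m + k) = aazG n m := by
      intro k
      induction k with
      | zero => rfl
      | succ k ih =>
        have := (aazF_zero n (m + k)).1 (hm _ (by omega))
        rw [← add_assoc, aazG_succ, this]; exact ih
    refine ⟨aazG n m, fun s => ?_⟩
    by_contra h
    have h1 := aazStep_mono (Nat.le_add_left s m) (by simpa using h)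
    have h2 := (aazF_zero n (m + s)).1 (hm _ (by omega))
    rw [hc, h1] at h2
    cases h2
  · rintro ⟨y, hy⟩
    have hb : ∀ s, aazG n s ≤ y := by
      intro s
      induction s with
      | zero => exact Nat.zero_le _
      | succ s ih =>
        rw [aazG_succ]
        rcases ih.eq_or_lt with h | h
        · rw [h, hy]; simp
        · cases aazStep n s (aazG n s) <;> simp <;> omega
    by_contra! hcon
    have hu : ∀ k, ∃ s, k ≤ aazG n s := by
      intro k
      induction k with
      | zero => exact ⟨0, Nat.zero_le _⟩
      | succ k ih =>
        obtain ⟨s, hs⟩ := ih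
        obtain ⟨t, ht, h⟩ := hcon s
        refine ⟨t + 1, ?_⟩
        rw [Ne, aazF_zero, Bool.not_eq_false] at h
        rw [aazG_succ, h]
        have := aazG_mono n ht
        simp; omega
    obtain ⟨s, hs⟩ := hu (y + 1)
    have := hb s
    omega

theorem aaz_isSigma2 (F : ℕ → ℕ → ℕ) (hF : Primrec₂ F) :
    IsSigma2 fun n => ∃ m, ∀ y ≥ m, F n y = 0 := by
  refine ⟨fun n m y => bif decide (m ≤ y) then decide (F n y = 0) else true, ?_, ?_⟩
  · have hm : Primrec fun p : ℕ × ℕ × ℕ => p.2.1 := Primrec.fst.comp Primrec.snd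
    have hy : Primrec fun p : ℕ × ℕ × ℕ => p.2.2 := Primrec.snd.comp Primrec.snd
    have h1 : Primrec fun p : ℕ × ℕ × ℕ => decide (p.2.1 ≤ p.2.2) :=
      (Primrec.nat_le.comp hm hy).decide
    have h2 : Primrec fun p : ℕ × ℕ × ℕ => decide (F p.1 p.2.2 = 0) :=
      (Primrec.eq.comp (hF.comp Primrec.fst hy) (Primrec.const 0)).decide
    exact (Primrec.cond h1 h2 (Primrec.const true)).to_comp
  · intro n
    refine exists_congr fun m => forall_congr' fun y => ?_
    by_cases h : m ≤ y <;> simp [h]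

open Nat.Partrec in
theorem aaz_hard (P : ℕ → Prop) (hP : IsSigma2 P) :
    ManyOneReducible P fun n => ∃ m, ∀ y ≥ m, aazF n y = 0 := by
  obtain ⟨R, hR, hPR⟩ := hP
  let f : ℕ →. ℕ := fun p =>
    Nat.rfind fun z => Part.some (!R p.unpair.1 p.unpair.2 z)
  have hf : Partrec f := by
    have hu : Computable fun q : ℕ × ℕ => q.1.unpair := Computable.unpair.comp Computable.fst
    have h0 : Computable fun q : ℕ × ℕ => ((q.1.unpair.1, q.1.unpair.2, q.2) : ℕ × ℕ × ℕ) :=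
      Computable.pair (Computable.fst.comp hu)
        (Computable.pair (Computable.snd.comp hu) Computable.snd)
    have h1 : Computable fun q : ℕ × ℕ => R q.1.unpair.1 q.1.unpair.2 q.2 := by
      have h3 := Computable.comp (f := fun p : ℕ × ℕ × ℕ => R p.1 p.2.1 p.2.2)
        (g := fun q : ℕ × ℕ => ((q.1.unpair.1, q.1.unpair.2, q.2) : ℕ × ℕ × ℕ)) hR h0
      exact h3
    have h : Computable fun q : ℕ × ℕ => !R q.1.unpair.1 q.1.unpair.2 q.2 :=
      Computable.comp (f := not) Primrec.not.to_comp h1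
    have h2 : Partrec₂ fun (p z : ℕ) => Part.some (!R p.unpair.1 p.unpair.2 z) := h.partrec
    exact Partrec.rfind h2
  obtain ⟨c, hc⟩ := Code.exists_code.1 (Partrec.nat_iff.1 hf)
  refine ⟨fun x => Nat.pair (Encodable.encode c) x,
    (Primrec₂.natPair.comp (Primrec.const _) Primrec.id).to_comp, fun x => ?_⟩
  beta_reduce
  rw [aazF_iff, hPR]
  refine exists_congr fun y => ?_
  have key : (∃ z, R x y z = false) ↔ ∃ s, aazStep (Nat.pair (Encodable.encode c) x) s y = true := by
    have h1 : (∃ z, R x y z = false) ↔ (f (Nat.pair x y)).Dom := by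
      simp only [f, Nat.unpair_pair]
      refine Iff.trans ?_ (Nat.rfind_dom (p := fun z => Part.some (!R x y z))).symm
      simp
    rw [h1, ← hc, Part.dom_iff_mem]
    simp only [Code.evaln_complete, aazStep, Nat.unpair_pair, Denumerable.ofNat_encode,
      Option.isSome_iff_exists, Option.mem_def]
    exact exists_comm
  have := not_congr key
  simpa using this

theorem almostAllZeros_Sigma2_complete :
    (∀ F : ℕ → ℕ → ℕ, Primrec₂ F → IsSigma2 fun n => ∃ m, ∀ y ≥ m, F n y = 0) ∧
    (∃ F : ℕ → ℕ → ℕ, Primrec₂ F ∧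
      Sigma2Complete fun n => ∃ m, ∀ y ≥ m, F n y = 0) :=
  ⟨aaz_isSigma2, aazF, aazF_prim, aaz_isSigma2 _ aazF_prim, aaz_hard⟩
end

section
/- The problem FINITE-CODOMAIN for primitive recursive functions is Σ2-complete, in the following uniform sense: (i) for every primitive recursive family F, the set {n : ℕ | the range of F n is finite} is Σ2; and (ii) there exists a primitive recursive family F such that the set {n : ℕ | the range of F n is finite} is Σ2-complete, i.e. every Σ2 subset of ℕ many-one reduces to it. -/
def FC.st (R : ℕ → ℕ → ℕ → Bool) (n t : ℕ) : ℕ × ℕ :=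
  Nat.rec (0, 0) (fun _ s => bif R n s.1 s.2 then (s.1, s.2 + 1) else (s.1 + 1, 0)) t

theorem FC.st_succ (R : ℕ → ℕ → ℕ → Bool) (n t : ℕ) :
    FC.st R n (t+1) = bif R n (FC.st R n t).1 (FC.st R n t).2
      then ((FC.st R n t).1, (FC.st R n t).2 + 1) else ((FC.st R n t).1 + 1, 0) := rfl

theorem FC.st_comp (R : ℕ → ℕ → ℕ → Bool)
    (hR : Computable (fun p : ℕ × ℕ × ℕ => R p.1 p.2.1 p.2.2)) :
    Computable (fun p : ℕ × ℕ => FC.st R p.1 p.2) := by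
  have hs : Computable (fun q : (ℕ × ℕ) × (ℕ × (ℕ × ℕ)) => q.2.2) :=
    Computable.snd.comp Computable.snd
  have h1 := Computable.fst.comp hs
  have h2 := Computable.snd.comp hs
  have hn : Computable (fun q : (ℕ × ℕ) × (ℕ × (ℕ × ℕ)) => q.1.1) :=
    Computable.fst.comp Computable.fst
  have hstep : Computable₂ (fun (p : ℕ × ℕ) (q : ℕ × (ℕ × ℕ)) =>
      bif R p.1 q.2.1 q.2.2 then (q.2.1, q.2.2 + 1) else (q.2.1 + 1, 0)) := by
    have hc : Computable (fun q : (ℕ × ℕ) × (ℕ × (ℕ × ℕ)) => R q.1.1 q.2.2.1 q.2.2.2) :=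
      Computable.comp (f := fun p : ℕ × ℕ × ℕ => R p.1 p.2.1 p.2.2)
        (g := fun q : (ℕ × ℕ) × (ℕ × (ℕ × ℕ)) => (q.1.1, q.2.2.1, q.2.2.2)) hR
        (hn.pair (h1.pair h2))
    have ha : Computable (fun q : (ℕ × ℕ) × (ℕ × (ℕ × ℕ)) => (q.2.2.1, q.2.2.2 + 1)) :=
      h1.pair (Computable.succ.comp h2)
    have hb : Computable (fun q : (ℕ × ℕ) × (ℕ × (ℕ × ℕ)) => (q.2.2.1 + 1, 0)) :=
      (Computable.succ.comp h1).pair (Computable.const 0)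
    exact Computable.cond hc ha hb
  have := Computable.nat_rec (f := fun p : ℕ × ℕ => p.2)
    (g := fun _ : ℕ × ℕ => ((0, 0) : ℕ × ℕ))
    Computable.snd (Computable.const _) hstep
  exact this

theorem FC.st_fin (R : ℕ → ℕ → ℕ → Bool) (n : ℕ) :
    (Set.range (fun t => (FC.st R n t).1)).Finite ↔ ∃ y, ∀ z, R n y z = true := by
  constructor
  · intro hf
    by_contra! hc
    have key : ∀ y, ∃ t, FC.st R n t = (y, 0) := by
      intro y
      induction y with
      | zero => exact ⟨0, rfl⟩
      | succ y ih =>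
        obtain ⟨t, ht⟩ := ih
        have hm := fun j => Nat.find_min (hc y) (m := j)
        have hz := Nat.find_spec (hc y)
        generalize Nat.find (hc y) = z at hm hz
        have : ∀ j, j ≤ z → FC.st R n (t + j) = (y, j) := by
          intro j
          induction j with
          | zero => intro _; exact ht
          | succ j ih =>
            intro hj
            have h1 := hm j (by omega)
            rw [← add_assoc, FC.st_succ, ih (by omega)]
            simp_all
        refine ⟨t + z + 1, ?_⟩
        rw [FC.st_succ, this z le_rfl]
        simp_all
    have : Set.range (fun t => (FC.st R n t).1) = Set.univ := by
      ext y
      obtain ⟨t, ht⟩ := key y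
      simp only [Set.mem_range, Set.mem_univ, iff_true]
      exact ⟨t, by rw [ht]⟩
    rw [this] at hf
    exact Set.infinite_univ hf
  · rintro ⟨y, hy⟩
    refine (Set.finite_Iic y).subset ?_
    rintro _ ⟨t, rfl⟩
    simp only [Set.mem_Iic]
    induction t with
    | zero => exact Nat.zero_le _
    | succ t ih =>
      rw [FC.st_succ]
      cases h : R n (FC.st R n t).1 (FC.st R n t).2 with
      | true => simpa using ih
      | false =>
        have : (FC.st R n t).1 ≠ y := by
          intro e; rw [e, hy] at h; cases h
        simp only [cond_false]; omega

def FC.F (e k : ℕ) : ℕ :=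
  bif (Nat.Partrec.Code.evaln k.unpair.1 (Denumerable.ofNat Nat.Partrec.Code e.unpair.1)
    (Nat.pair e.unpair.2 k.unpair.2)).isSome then k.unpair.2 else 0

theorem FC.F_prim : Primrec₂ FC.F := by
  have he : Primrec (fun p : ℕ × ℕ => p.1.unpair) := Primrec.unpair.comp Primrec.fst
  have hk : Primrec (fun p : ℕ × ℕ => p.2.unpair) := Primrec.unpair.comp Primrec.snd
  have hk2 := Primrec.snd.comp hk
  refine Primrec.cond (Primrec.option_isSome.comp (Nat.Partrec.Code.primrec_evaln.comp
    (((Primrec.fst.comp hk).pair ((Primrec.ofNat Nat.Partrec.Code).comp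
      (Primrec.fst.comp he))).pair
      (Primrec₂.natPair.comp (Primrec.snd.comp he) hk2)))) hk2 (Primrec.const 0)

theorem FC.sigma2 (F : ℕ → ℕ → ℕ) (hF : Primrec₂ F) :
    IsSigma2 fun n => (Set.range (F n)).Finite := by
  refine ⟨fun n y z => decide (F n z ≤ y), ?_, fun n => ?_⟩
  · have h : Primrec (fun p : ℕ × ℕ × ℕ => F p.1 p.2.2) :=
      hF.comp Primrec.fst (Primrec.snd.comp Primrec.snd)
    exact ((Primrec.nat_le.comp h (Primrec.fst.comp Primrec.snd)).decide).to_comp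
  · beta_reduce
    rw [Set.finite_iff_bddAbove]
    simp [BddAbove, Set.Nonempty, upperBounds]

theorem FC.red (P : ℕ → Prop) (hP : IsSigma2 P) :
    ManyOneReducible P fun n => (Set.range (FC.F n)).Finite := by
  obtain ⟨R, hR, hPR⟩ := hP
  have hst := FC.st_comp R hR
  have hp : Computable₂ (fun (a t : ℕ) => decide ((FC.st R a.unpair.1 t).1 = a.unpair.2)) := by
    have hu : Computable (fun p : ℕ × ℕ => p.1.unpair) := Computable.unpair.comp Computable.fst
    have := (Primrec.eq (α := ℕ)).decide.to_comp
    have hg : Computable (fun p : ℕ × ℕ => (p.1.unpair.1, p.2)) :=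
      (Computable.fst.comp hu).pair Computable.snd
    have h3 : Computable (fun p : ℕ × ℕ => FC.st R p.1.unpair.1 p.2) :=
      Computable.comp (f := fun p : ℕ × ℕ => FC.st R p.1 p.2)
        (g := fun p : ℕ × ℕ => (p.1.unpair.1, p.2)) hst hg
    have h4 : Computable (fun p : ℕ × ℕ => (FC.st R p.1.unpair.1 p.2).1) :=
      Computable.fst.comp h3
    have h5 : Computable (fun p : ℕ × ℕ => p.1.unpair.2) := Computable.snd.comp hu
    exact this.comp h4 h5
  have hr := Partrec.rfind hp.partrec₂
  obtain ⟨c, hc⟩ := Nat.Partrec.Code.exists_code.1 (Partrec.nat_iff.1 hr)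
  refine ⟨fun n => Nat.pair (Encodable.encode c) n,
    (Primrec₂.natPair.comp (Primrec.const _) Primrec.id).to_comp, fun n => ?_⟩
  rw [hPR, ← FC.st_fin]
  have hdom : ∀ x, (∃ k, (Nat.Partrec.Code.evaln k c (Nat.pair n x)).isSome) ↔
      ∃ t, (FC.st R n t).1 = x := by
    intro x
    have h1 : (∃ k, (Nat.Partrec.Code.evaln k c (Nat.pair n x)).isSome) ↔
        (c.eval (Nat.pair n x)).Dom := by
      rw [Part.dom_iff_mem]
      simp only [Nat.Partrec.Code.evaln_complete, Option.isSome_iff_exists, Option.mem_def]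
      exact exists_comm
    rw [h1, hc, Nat.rfind_dom]
    simp
  have : Set.range (FC.F (Nat.pair (Encodable.encode c) n)) =
      Set.range (fun t => (FC.st R n t).1) := by
    ext x
    simp only [Set.mem_range]
    rw [← hdom]
    constructor
    · rintro ⟨k, rfl⟩
      simp only [FC.F, Nat.unpair_pair, Denumerable.ofNat_encode]
      cases h : (Nat.Partrec.Code.evaln k.unpair.1 c (Nat.pair n k.unpair.2)).isSome with
      | true => exact ⟨_, h⟩
      | false => exact (hdom 0).2 ⟨0, rfl⟩
    · rintro ⟨k, hk⟩
      refine ⟨Nat.pair k x, ?_⟩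
      simp [FC.F, hk]
  beta_reduce
  rw [this]

theorem finiteCodomain_Sigma2_complete :
    (∀ F : ℕ → ℕ → ℕ, Primrec₂ F → IsSigma2 fun n => (Set.range (F n)).Finite) ∧
    (∃ F : ℕ → ℕ → ℕ, Primrec₂ F ∧
      Sigma2Complete fun n => (Set.range (F n)).Finite) :=
  ⟨FC.sigma2, FC.F, FC.F_prim, FC.sigma2 _ FC.F_prim, FC.red⟩
end

section
/- The problem ONTO (surjectivity) for primitive recursive functions is Π2-complete, in the following uniform sense: (i) for every primitive recursive family F, the set {n : ℕ | F n : ℕ → ℕ is surjective} is Π2; and (ii) there exists a primitive recursive family F such that the set {n : ℕ | F n is surjective} is Π2-complete, i.e. every Π2 subset of ℕ many-one reduces to it. -/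
open Nat.Partrec in
def ontoFam (n x : ℕ) : ℕ :=
  if (Code.evaln x.unpair.2 (Denumerable.ofNat Code n) x.unpair.1).isSome = true
  then x.unpair.1 + 1 else 0

open Nat.Partrec in
theorem ontoFam_primrec : Primrec₂ ontoFam := by
  have hu : Primrec (fun p : ℕ × ℕ => p.2.unpair) := Primrec.unpair.comp Primrec.snd
  have h1 : Primrec (fun p : ℕ × ℕ => p.2.unpair.1) := Primrec.fst.comp hu
  have h2 : Primrec (fun p : ℕ × ℕ => p.2.unpair.2) := Primrec.snd.comp hu
  have h3 : Primrec (fun p : ℕ × ℕ => Denumerable.ofNat Code p.1) :=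
    (Primrec.ofNat Code).comp Primrec.fst
  have h4 : Primrec (fun p : ℕ × ℕ =>
      (Code.evaln p.2.unpair.2 (Denumerable.ofNat Code p.1) p.2.unpair.1).isSome) :=
    Primrec.option_isSome.comp (Code.primrec_evaln.comp ((h2.pair h3).pair h1))
  exact Primrec.ite (Primrec.eq.comp h4 (Primrec.const true)) (Primrec.succ.comp h1)
    (Primrec.const 0)

open Nat.Partrec in
theorem ontoFam_surj (n : ℕ) : Function.Surjective (ontoFam n) ↔
    ∀ y, (Code.eval (Denumerable.ofNat Code n) y).Dom := by
  constructor
  · intro h y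
    obtain ⟨x, hx⟩ := h (y + 1)
    unfold ontoFam at hx
    split_ifs at hx with hs
    obtain ⟨v, hv⟩ := Option.isSome_iff_exists.1 hs
    have hy : x.unpair.1 = y := by omega
    rw [hy] at hv
    exact Part.dom_iff_mem.2 ⟨v, Code.evaln_sound hv⟩
  · intro h y
    cases y with
    | zero =>
      refine ⟨Nat.pair 0 0, ?_⟩
      simp [ontoFam, Code.evaln]
    | succ y =>
      obtain ⟨v, hv⟩ := Part.dom_iff_mem.1 (h y)
      obtain ⟨k, hk⟩ := Code.evaln_complete.1 hv
      refine ⟨Nat.pair y k, ?_⟩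
      have : Code.evaln k (Denumerable.ofNat Code n) y = some v := hk
      simp [ontoFam, this]

theorem onto_isPi2 (F : ℕ → ℕ → ℕ) (hF : Primrec₂ F) :
    IsPi2 fun n => Function.Surjective (F n) := by
  refine ⟨fun n y z => decide (F n z = y), ?_, fun n => by simp [Function.Surjective]⟩
  have h : Primrec (fun p : ℕ × ℕ × ℕ => F p.1 p.2.2) :=
    hF.comp Primrec.fst (Primrec.snd.comp Primrec.snd)
  have h2 : PrimrecPred (fun p : ℕ × ℕ × ℕ => F p.1 p.2.2 = p.2.1) :=
    Primrec.eq.comp h (Primrec.fst.comp Primrec.snd)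
  exact h2.decide.to_comp

open Nat.Partrec in
theorem onto_curry_comp (c : Code) : Computable fun n => Encodable.encode (Code.curry c n) := by
  have h1 : Primrec (fun n => Code.curry c n) :=
    Code.primrec₂_curry.comp (Primrec.const c) Primrec.id
  have h2 : Primrec (fun n => Encodable.encode (Code.curry c n)) := Primrec.encode.comp h1
  exact h2.to_comp

theorem onto_rfind (f : ℕ → ℕ → Bool) (hf : Computable₂ f) :
    Partrec (fun a : ℕ => Nat.rfind (fun z => Part.some (f a z))) :=
  Partrec.rfind hf.partrec₂

theorem onto_search (R : ℕ → ℕ → ℕ → Bool)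
    (hR : Computable (fun p : ℕ × ℕ × ℕ => R p.1 p.2.1 p.2.2)) :
    Partrec (fun a : ℕ => Nat.rfind (fun z => Part.some (R a.unpair.1 a.unpair.2 z))) := by
  have hu : Computable (fun p : ℕ × ℕ => p.1.unpair) := Computable.unpair.comp Computable.fst
  have hq : Computable (fun p : ℕ × ℕ => (p.1.unpair.1, p.1.unpair.2, p.2)) :=
    (Computable.fst.comp hu).pair ((Computable.snd.comp hu).pair Computable.snd)
  have hc : Computable₂ (fun a z : ℕ => R a.unpair.1 a.unpair.2 z) :=
    Computable.to₂ (Computable.comp hR hq)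
  exact onto_rfind _ hc

open Nat.Partrec in
theorem onto_hard (P : ℕ → Prop) (hP : IsPi2 P) :
    ManyOneReducible P fun n => Function.Surjective (ontoFam n) := by
  obtain ⟨R, hR, h⟩ := hP
  obtain ⟨c, hcode⟩ := Code.exists_code.1 (Partrec.nat_iff.1 (onto_search R hR))
  refine ⟨fun n => Encodable.encode (Code.curry c n), onto_curry_comp c, fun n => ?_⟩
  have key : ∀ y, (∃ z, R n y z = true) ↔ (Code.eval (Code.curry c n) y).Dom := by
    intro y
    rw [Code.eval_curry, hcode]
    have hd : (Nat.rfind fun z => Part.some (R n y z)).Dom ↔ ∃ z, R n y z = true := by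
      refine Nat.rfind_dom.trans ?_
      constructor
      · rintro ⟨z, hz, -⟩
        exact ⟨z, (Part.mem_some_iff.1 hz).symm⟩
      · rintro ⟨z, hz⟩
        exact ⟨z, Part.mem_some_iff.2 hz.symm, fun _ => trivial⟩
    simpa using hd.symm
  have hs := ontoFam_surj (Encodable.encode (Code.curry c n))
  rw [Denumerable.ofNat_encode] at hs
  exact (h n).trans ((forall_congr' key).trans hs.symm)

theorem onto_Pi2_complete :
    (∀ F : ℕ → ℕ → ℕ, Primrec₂ F → IsPi2 fun n => Function.Surjective (F n)) ∧
    (∃ F : ℕ → ℕ → ℕ, Primrec₂ F ∧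
      Pi2Complete fun n => Function.Surjective (F n)) := by
  exact ⟨onto_isPi2, ontoFam, ontoFam_primrec, onto_isPi2 _ ontoFam_primrec, onto_hard⟩
end

section
/- The problem BIJECTIVE for primitive recursive functions is Π2-complete, in the following uniform sense: (i) for every primitive recursive family F, the set {n : ℕ | F n : ℕ → ℕ is bijective} is Π2; and (ii) there exists a primitive recursive family F such that the set {n : ℕ | F n is bijective} is Π2-complete, i.e. every Π2 subset of ℕ many-one reduces to it. -/
open Nat.Partrec (Code)

def colH (n y k : ℕ) : Bool := (Code.evaln k (Denumerable.ofNat Code n) y).isSome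

def colG (n y k : ℕ) : ℕ :=
  bif colH n y k then (bif colH n y (k - 1) then k else 0) else k + 1

def famF (n x : ℕ) : ℕ := Nat.pair x.unpair.1 (colG n x.unpair.1 x.unpair.2)

theorem colH_zero (n y : ℕ) : colH n y 0 = false := by
  simp [colH, Code.evaln]

theorem colH_mono {n y k l : ℕ} (hkl : k ≤ l) (h : colH n y k = true) : colH n y l = true := by
  unfold colH at *
  rw [Option.isSome_iff_exists] at *
  obtain ⟨x, hx⟩ := h
  exact ⟨x, Code.evaln_mono hkl hx⟩

theorem colH_dom (n y : ℕ) :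
    (∃ k, colH n y k = true) ↔ (Code.eval (Denumerable.ofNat Code n) y).Dom := by
  rw [Part.dom_iff_mem]
  simp only [Code.evaln_complete, colH, Option.isSome_iff_exists]
  exact exists_comm

theorem colG_inj (n y : ℕ) : Function.Injective (colG n y) := by
  intro a b hab
  have h1 := @colH_mono n y a b
  have h2 := @colH_mono n y b a
  have h3 := @colH_mono n y a (b-1)
  have h4 := @colH_mono n y b (a-1)
  have h0 := colH_zero n y
  unfold colG at hab
  have h5 : colH n y a = true → a ≠ 0 := by rintro h rfl; simp [h0] at h
  have h6 : colH n y b = true → b ≠ 0 := by rintro h rfl; simp [h0] at h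
  have h7 := @colH_mono n y (a-1) b
  have h8 := @colH_mono n y (b-1) a
  cases ha : colH n y a <;> cases hb : colH n y b <;> cases ha' : colH n y (a-1) <;>
    cases hb' : colH n y (b-1) <;> simp_all <;> grind

theorem colG_surj (n y : ℕ) : Function.Surjective (colG n y) ↔ ∃ k, colH n y k = true := by
  constructor
  · intro h
    obtain ⟨k, hk⟩ := h 0
    refine ⟨k, ?_⟩
    by_contra hc
    simp [colG, Bool.eq_false_iff.2 hc] at hk
  · intro h m
    classical
    have hk := Nat.find_spec h
    have hlt : ∀ j < Nat.find h, colH n y j = false := fun j hj => by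
      simpa using Nat.find_min h hj
    generalize Nat.find h = k at *
    have hk0 : k ≠ 0 := by rintro rfl; simp [colH_zero] at hk
    rcases Nat.eq_zero_or_pos m with rfl | hm
    · exact ⟨k, by simp [colG, hk, hlt (k-1) (by omega)]⟩
    · by_cases hmk : m ≤ k
      · exact ⟨m - 1, by simp [colG, hlt (m-1) (by omega)]; omega⟩
      · exact ⟨m, by simp [colG, colH_mono (show k ≤ m by omega) hk,
          colH_mono (show k ≤ m - 1 by omega) hk]⟩

theorem famF_bij (n : ℕ) : Function.Bijective (famF n) ↔
    ∀ y, (Code.eval (Denumerable.ofNat Code n) y).Dom := by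
  simp only [← colH_dom, ← colG_surj]
  constructor
  · rintro ⟨-, hs⟩ y m
    obtain ⟨x, hx⟩ := hs (Nat.pair y m)
    simp only [famF, Nat.pair_eq_pair] at hx
    obtain ⟨rfl, hx⟩ := hx
    exact ⟨_, hx⟩
  · intro h
    constructor
    · intro a b hab
      simp only [famF, Nat.pair_eq_pair] at hab
      obtain ⟨h1, h2⟩ := hab
      rw [h1] at h2
      rw [← Nat.pair_unpair a, ← Nat.pair_unpair b, h1, colG_inj _ _ h2]
    · intro b
      obtain ⟨k, hk⟩ := h b.unpair.1 b.unpair.2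
      exact ⟨Nat.pair b.unpair.1 k, by simp [famF, hk]⟩

theorem colH_primrec : Primrec fun p : ℕ × ℕ × ℕ => colH p.1 p.2.1 p.2.2 := by
  unfold colH
  refine Primrec.option_isSome.comp (Code.primrec_evaln.comp
    (f := fun a : (ℕ × Code) × ℕ => Code.evaln a.1.1 a.1.2 a.2)
    (g := fun p : ℕ × ℕ × ℕ => ((p.2.2, Denumerable.ofNat Code p.1), p.2.1)) ?_)
  exact ((Primrec.snd.comp Primrec.snd).pair ((Primrec.ofNat Code).comp Primrec.fst)).pair
    (Primrec.fst.comp Primrec.snd)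

theorem famF_primrec : Primrec₂ famF := by
  have hy : Primrec fun p : ℕ × ℕ => p.2.unpair.1 :=
    Primrec.fst.comp (Primrec.unpair.comp Primrec.snd)
  have hk : Primrec fun p : ℕ × ℕ => p.2.unpair.2 :=
    Primrec.snd.comp (Primrec.unpair.comp Primrec.snd)
  have hk1 : Primrec fun p : ℕ × ℕ => p.2.unpair.2 - 1 := Primrec.pred.comp hk
  have hk2 : Primrec fun p : ℕ × ℕ => p.2.unpair.2 + 1 := Primrec.succ.comp hk
  have a1 := colH_primrec.comp (Primrec.fst.pair (hy.pair hk))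
  have a2 := colH_primrec.comp (Primrec.fst.pair (hy.pair hk1))
  exact Primrec₂.natPair.comp hy (Primrec.cond a1 (Primrec.cond a2 hk (Primrec.const 0)) hk2)

theorem bij_isPi2 (F : ℕ → ℕ → ℕ) (hF : Primrec₂ F) :
    IsPi2 fun n => Function.Bijective (F n) := by
  refine ⟨fun n y z => (! (F n y.unpair.1.unpair.1 == F n y.unpair.1.unpair.2) ||
    (y.unpair.1.unpair.1 == y.unpair.1.unpair.2)) && (F n z == y.unpair.2), ?_, ?_⟩
  · apply Primrec.to_comp
    have hy : Primrec fun p : ℕ × ℕ × ℕ => p.2.1.unpair :=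
      Primrec.unpair.comp (Primrec.fst.comp Primrec.snd)
    have hab := Primrec.unpair.comp (Primrec.fst.comp hy)
    have ha := Primrec.fst.comp hab
    have hb := Primrec.snd.comp hab
    have hc := Primrec.snd.comp hy
    have hz : Primrec fun p : ℕ × ℕ × ℕ => p.2.2 := Primrec.snd.comp Primrec.snd
    exact Primrec.and.comp (Primrec.or.comp
      (Primrec.not.comp (Primrec.beq.comp (hF.comp Primrec.fst ha) (hF.comp Primrec.fst hb)))
      (Primrec.beq.comp ha hb)) (Primrec.beq.comp (hF.comp Primrec.fst hz) hc)
  · intro n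
    constructor
    · rintro ⟨hi, hs⟩ y
      obtain ⟨z, hz⟩ := hs y.unpair.2
      refine ⟨z, ?_⟩
      by_cases h : F n y.unpair.1.unpair.1 = F n y.unpair.1.unpair.2
      · simp [hz, hi h]
      · simp [hz, h]
    · intro h
      constructor
      · intro a b hab
        obtain ⟨z, hz⟩ := h (Nat.pair (Nat.pair a b) 0)
        simp [hab] at hz
        exact hz.1
      · intro c
        obtain ⟨z, hz⟩ := h (Nat.pair (Nat.pair 0 0) c)
        simp at hz
        exact ⟨z, hz⟩

theorem famF_hard (P : ℕ → Prop) (hP : IsPi2 P) :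
    ManyOneReducible P fun n => Function.Bijective (famF n) := by
  obtain ⟨R, hR, hPR⟩ := hP
  have hp : Partrec fun x : ℕ => Nat.rfind fun z => Part.some (R x.unpair.1 x.unpair.2 z) := by
    apply Partrec.rfind
    have : Computable fun p : ℕ × ℕ => R p.1.unpair.1 p.1.unpair.2 p.2 := by
      have hu : Computable fun p : ℕ × ℕ => p.1.unpair :=
        Computable.unpair.comp Computable.fst
      have hg : Computable fun p : ℕ × ℕ => (p.1.unpair.1, p.1.unpair.2, p.2) :=
        (Computable.fst.comp hu).pair ((Computable.snd.comp hu).pair Computable.snd)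
      exact Computable.comp (f := fun p : ℕ × ℕ × ℕ => R p.1 p.2.1 p.2.2)
        (g := fun p : ℕ × ℕ => (p.1.unpair.1, p.1.unpair.2, p.2)) hR hg
    exact Computable.partrec this
  obtain ⟨c, hc⟩ := Code.exists_code.1 (Partrec.nat_iff.1 hp)
  refine ⟨fun n => Encodable.encode (Code.curry c n), ?_, ?_⟩
  · exact Computable.encode.comp
      (Code.primrec₂_curry.comp (Primrec.const c) Primrec.id).to_comp
  · intro n
    rw [hPR]
    beta_reduce
    rw [famF_bij]
    refine forall_congr' fun y => ?_
    rw [Denumerable.ofNat_encode, Code.eval_curry, hc]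
    simp only [Nat.unpair_pair]
    constructor
    · rintro ⟨z, hz⟩
      exact Nat.rfind_dom.2 ⟨z, by simp [hz], fun _ => trivial⟩
    · intro h
      obtain ⟨z, hz, -⟩ := Nat.rfind_dom.1 h
      exact ⟨z, by simpa using hz⟩

theorem bijective_Pi2_complete :
    (∀ F : ℕ → ℕ → ℕ, Primrec₂ F → IsPi2 fun n => Function.Bijective (F n)) ∧
    (∃ F : ℕ → ℕ → ℕ, Primrec₂ F ∧
      Pi2Complete fun n => Function.Bijective (F n)) :=
  ⟨bij_isPi2, famF, famF_primrec, bij_isPi2 famF famF_primrec, famF_hard⟩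
end

section
/- Frontier of decidability for input restriction: let g : ℕ → ℕ be a primitive recursive function. Then the range of g is infinite if and only if there exists a primitive recursive family F such that the set {n : ℕ | ∃ x, F n (g x) = 0} is not decidable (i.e. not a computable predicate). In particular, if the range of g is finite, then for every primitive recursive family F the set {n : ℕ | ∃ x, F n (g x) = 0} is computable. -/
open Nat.Partrec in
theorem hz_finite (g : ℕ → ℕ) (h : (Set.range g).Finite) (F : ℕ → ℕ → ℕ) (hF : Primrec₂ F) :
    ComputablePred fun n => ∃ x, F n (g x) = 0 := by
  have key : ∀ s : Finset ℕ, PrimrecPred fun n => ∃ y ∈ s, F n y = 0 := by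
    intro s
    induction s using Finset.induction_on with
    | empty => simpa using (PrimrecPred.not (Primrec.eq.comp (Primrec.id (α := ℕ)) Primrec.id))
    | insert a s _ ih =>
      have h1 : PrimrecPred fun n => F n a = 0 :=
        Primrec.eq.comp (hF.comp Primrec.id (Primrec.const a)) (Primrec.const 0)
      exact (h1.or ih).of_eq fun n => by simp
  have h2 := key h.toFinset
  have h3 : PrimrecPred fun n => ∃ x, F n (g x) = 0 := h2.of_eq fun n => by simp
  obtain ⟨hd, hp⟩ := h3
  exact ⟨hd, hp.to_comp⟩

open Nat.Partrec in
theorem hz_infinite (g : ℕ → ℕ) (h : (Set.range g).Infinite) :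
    ∃ F : ℕ → ℕ → ℕ, Primrec₂ F ∧ ¬ ComputablePred fun n => ∃ x, F n (g x) = 0 := by
  refine ⟨fun n y => 1 - Encodable.encode (Code.evaln y (Denumerable.ofNat Code n) 0), ?_, ?_⟩
  · exact Primrec.nat_sub.comp (Primrec.const 1) (Primrec.encode.comp
      (Code.primrec_evaln.comp (Primrec.pair (Primrec.pair Primrec.snd
        ((Primrec.ofNat Code).comp Primrec.fst)) (Primrec.const 0))))
  · intro hc
    apply ComputablePred.halting_problem 0
    have : ComputablePred fun c : Code => ∃ x, 1 - Encodable.encode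
        (Code.evaln (g x) (Denumerable.ofNat Code (Encodable.encode c)) 0) = 0 :=
      ComputablePred.computable_of_manyOneReducible ⟨_, Computable.encode, fun c => Iff.rfl⟩ hc
    refine this.of_eq fun c => ?_
    simp only [Denumerable.ofNat_encode, Part.dom_iff_mem, Code.evaln_complete]
    constructor
    · rintro ⟨x, hx⟩
      cases e : Code.evaln (g x) c 0 with
      | none => simp [e] at hx
      | some a => exact ⟨a, g x, e⟩
    · rintro ⟨a, k, hk⟩
      obtain ⟨_, ⟨x, rfl⟩, hx⟩ := h.exists_gt k
      have := Code.evaln_mono hx.le hk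
      refine ⟨x, ?_⟩
      rw [Option.mem_def] at this
      simp [this]

theorem hasZeros_input_restriction_frontier (g : ℕ → ℕ) (hg : Primrec g) :
    ((Set.range g).Infinite ↔
      ∃ F : ℕ → ℕ → ℕ, Primrec₂ F ∧
        ¬ ComputablePred fun n => ∃ x, F n (g x) = 0) ∧
    ((Set.range g).Finite →
      ∀ F : ℕ → ℕ → ℕ, Primrec₂ F →
        ComputablePred fun n => ∃ x, F n (g x) = 0) := by
  refine ⟨⟨hz_infinite g, ?_⟩, hz_finite g⟩
  rintro ⟨F, hF, hn⟩ hfin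
  exact hn (hz_finite g hfin F hF)
end

section
/- Frontier of decidability for output restriction: let h : ℕ → ℕ be a primitive recursive function. Then h takes the value 0 at some point and a nonzero value at some point (∃ a, h a = 0 and ∃ b, h b ≠ 0) if and only if there exists a primitive recursive family F such that the set {n : ℕ | ∃ x, h (F n x) = 0} is not decidable (i.e. not a computable predicate). In particular, if h never takes the value 0, or h is identically 0, then for every primitive recursive family F the set {n : ℕ | ∃ x, h (F n x) = 0} is computable. -/
theorem aux_const (h : ℕ → ℕ) (H : (∀ a, h a ≠ 0) ∨ (∀ a, h a = 0)) (F : ℕ → ℕ → ℕ) :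
    ComputablePred fun n => ∃ x, h (F n x) = 0 := by
  rcases H with H | H
  · refine ComputablePred.of_eq (p := fun _ => False) ⟨inferInstance, ?_⟩ (by simp [H])
    exact (Computable.const false).of_eq (by simp)
  · refine ComputablePred.of_eq (p := fun _ => True) ⟨inferInstance, ?_⟩ (by simp [H])
    exact (Computable.const true).of_eq (by simp)

theorem aux_undec (h : ℕ → ℕ) (a b : ℕ) (ha : h a = 0) (hb : h b ≠ 0) :
    ∃ F : ℕ → ℕ → ℕ, Primrec₂ F ∧ ¬ ComputablePred fun n => ∃ x, h (F n x) = 0 := by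
  classical
  refine ⟨fun n k => Option.casesOn
    (Nat.Partrec.Code.evaln k (Denumerable.ofNat Nat.Partrec.Code n) 0) b (fun _ => a), ?_, ?_⟩
  · have h1 : Primrec fun p : ℕ × ℕ =>
        Nat.Partrec.Code.evaln p.2 (Denumerable.ofNat Nat.Partrec.Code p.1) 0 :=
      Nat.Partrec.Code.primrec_evaln.comp
        ((Primrec.snd.pair ((Primrec.ofNat Nat.Partrec.Code).comp Primrec.fst)).pair
          (Primrec.const 0))
    exact Primrec.option_casesOn h1 (Primrec.const b) (Primrec.const a).to₂
  · intro hc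
    apply ComputablePred.halting_problem 0
    obtain ⟨f, hf, hfe⟩ := ComputablePred.computable_iff.1 hc
    refine ComputablePred.computable_iff.2
      ⟨fun c => f (Encodable.encode c), hf.comp Computable.encode, ?_⟩
    funext c
    have h2 := congrFun hfe (Encodable.encode c)
    rw [← h2]
    simp only [Denumerable.ofNat_encode, eq_iff_iff]
    rw [Part.dom_iff_mem]
    constructor
    · rintro ⟨y, hy⟩
      obtain ⟨k, hk⟩ := Nat.Partrec.Code.evaln_complete.1 hy
      refine ⟨k, ?_⟩
      rw [Option.mem_def.1 hk]
      exact ha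
    · rintro ⟨k, hk⟩
      cases hE : Nat.Partrec.Code.evaln k c 0 with
      | none => rw [hE] at hk; exact absurd hk hb
      | some y => exact ⟨y, Nat.Partrec.Code.evaln_sound hE⟩

theorem hasZeros_output_restriction_frontier (h : ℕ → ℕ) (hh : Primrec h) :
    (((∃ a, h a = 0) ∧ ∃ b, h b ≠ 0) ↔
      ∃ F : ℕ → ℕ → ℕ, Primrec₂ F ∧
        ¬ ComputablePred fun n => ∃ x, h (F n x) = 0) ∧
    (((∀ a, h a ≠ 0) ∨ (∀ a, h a = 0)) →
      ∀ F : ℕ → ℕ → ℕ, Primrec₂ F →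
        ComputablePred fun n => ∃ x, h (F n x) = 0) := by
  refine ⟨⟨?_, ?_⟩, fun H F _ => aux_const h H F⟩
  · rintro ⟨⟨a, ha⟩, b, hb⟩
    exact aux_undec h a b ha hb
  · rintro ⟨F, _, hF⟩
    by_contra hn
    apply hF
    apply aux_const
    by_cases h0 : ∃ a, h a = 0
    · right
      intro x
      by_contra hx
      exact hn ⟨h0, x, hx⟩
    · left
      intro x hx
      exact h0 ⟨x, hx⟩
end

section
/- Frontier of decidability for combined input and output restriction: let g : ℕ → ℕ and h : ℕ → ℕ be primitive recursive functions. Then the following conjunction holds — the range of g is infinite, ∃ a, h a = 0, and ∃ b, h b ≠ 0 — if and only if there exists a primitive recursive family F such that the set {n : ℕ | ∃ x, h (F n (g x)) = 0} is not decidable (i.e. not a computable predicate). In particular, if the range of g is finite, or h never takes the value 0, or h is identically 0, then for every primitive recursive family F the set {n : ℕ | ∃ x, h (F n (g x)) = 0} is computable. -/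
open Nat.Partrec in
theorem frontier_undec (g h : ℕ → ℕ)
    (hi : (Set.range g).Infinite) (a b : ℕ) (ha : h a = 0) (hb : h b ≠ 0) :
    ∃ F : ℕ → ℕ → ℕ, Primrec₂ F ∧
        ¬ ComputablePred fun n => ∃ x, h (F n (g x)) = 0 := by
  refine ⟨fun n y => bif (Code.evaln y (Denumerable.ofNat Code n) 0).isSome then a else b, ?_, ?_⟩
  · refine Primrec.cond ?_ (Primrec.const a) (Primrec.const b)
    refine Primrec.option_isSome.comp ?_
    exact Code.primrec_evaln.comp
      (Primrec.pair (Primrec.pair Primrec.snd ((Primrec.ofNat Code).comp Primrec.fst))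
        (Primrec.const 0))
  · intro hc
    apply ComputablePred.halting_problem 0
    refine ComputablePred.computable_of_manyOneReducible
      (p := fun c : Code => (Code.eval c 0).Dom) ?_ hc
    refine ⟨Encodable.encode, Computable.encode, fun c => ?_⟩
    simp only [Denumerable.ofNat_encode]
    constructor
    · intro hd
      obtain ⟨k, hk⟩ := Code.evaln_complete.1 (Part.get_mem hd)
      obtain ⟨_, ⟨x, rfl⟩, hx⟩ := hi.exists_gt k
      refine ⟨x, ?_⟩
      have := Code.evaln_mono hx.le hk
      rw [Option.mem_def] at this
      simp [this, ha]
    · rintro ⟨x, hx⟩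
      cases hs : Code.evaln (g x) c 0 with
      | none => simp [hs, hb] at hx
      | some v => exact Part.dom_iff_mem.2 ⟨v, Code.evaln_sound hs⟩

theorem frontier_dec (g h : ℕ → ℕ) (hh : Primrec h)
    (H : (Set.range g).Finite ∨ (∀ a, h a ≠ 0) ∨ (∀ a, h a = 0))
    (F : ℕ → ℕ → ℕ) (hF : Primrec₂ F) :
    ComputablePred fun n => ∃ x, h (F n (g x)) = 0 := by
  suffices hp : PrimrecPred fun n => ∃ x, h (F n (g x)) = 0 by
    obtain ⟨_, hp⟩ := hp
    exact ⟨inferInstance, hp.to_comp⟩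
  rcases H with H | H | H
  · have hR : PrimrecRel fun y n => h (F n y) = 0 :=
      Primrec.eq.comp (hh.comp (hF.comp Primrec.snd Primrec.fst)) (Primrec.const 0)
    exact (hR.exists_mem_list.comp (Primrec.const H.toFinset.toList) Primrec.id).of_eq (by simp)
  · exact PrimrecPred.of_eq (p := fun _ : ℕ => False) ⟨inferInstance, Primrec.const _⟩ (by simp [H])
  · exact PrimrecPred.of_eq (p := fun _ : ℕ => True) ⟨inferInstance, Primrec.const _⟩ (by simp [H])

theorem hasZeros_inout_restriction_frontier (g h : ℕ → ℕ)
    (hg : Primrec g) (hh : Primrec h) :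
    (((Set.range g).Infinite ∧ (∃ a, h a = 0) ∧ ∃ b, h b ≠ 0) ↔
      ∃ F : ℕ → ℕ → ℕ, Primrec₂ F ∧
        ¬ ComputablePred fun n => ∃ x, h (F n (g x)) = 0) ∧
    (((Set.range g).Finite ∨ (∀ a, h a ≠ 0) ∨ (∀ a, h a = 0)) →
      ∀ F : ℕ → ℕ → ℕ, Primrec₂ F →
        ComputablePred fun n => ∃ x, h (F n (g x)) = 0) := by
  refine ⟨⟨?_, ?_⟩, frontier_dec g h hh⟩
  · rintro ⟨hi, ⟨a, ha⟩, b, hb⟩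
    exact frontier_undec g h hi a b ha hb
  · rintro ⟨F, hF, hn⟩
    refine ⟨fun hf => hn (frontier_dec g h hh (Or.inl hf) F hF), ?_, ?_⟩
    · by_contra hc
      exact hn (frontier_dec g h hh (Or.inr (Or.inl fun a e => hc ⟨a, e⟩)) F hF)
    · by_contra hc
      exact hn (frontier_dec g h hh
        (Or.inr (Or.inr fun a => by_contra fun e => hc ⟨a, e⟩)) F hF)
end
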